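/- arXiv:1107.0702 — 3 statements merged into one kernel-verified Lean document; each statement's English description precedes it below -/
import Mathlib

section
/- Let g be semisimple with g = b ⊕ u⁻ and the b-action on u⁻ given by b ∘ η = p₋([b,η]) where p₋ : g → u⁻ is the projection with kernel b. If t ∈ t is regular and u ∈ u is arbitrary, then (t+u) ∘ u⁻ = u⁻, i.e., the map η ↦ p₋([t+u, η]) from u⁻ to u⁻ is surjective. -/
/-- In a finite-dimensional space, an endomorphism that is surjective modulo an invariant
subspace `S` is injective modulo `S`. -/
theorem mem_of_apply_mem_aux {k V : Type*} [Field k] [AddCommGroup V] [Module k V]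
    [FiniteDimensional k V] (f : V →ₗ[k] V) (S : Submodule k V) (hS : ∀ x ∈ S, f x ∈ S)
    (hsurj : ∀ x, ∃ y, x - f y ∈ S) (v : V) (hv : f v ∈ S) : v ∈ S := by
  let q : (V ⧸ S) →ₗ[k] (V ⧸ S) := S.mapQ S f (fun x hx => hS x hx)
  have hq : Function.Surjective q := by
    intro z
    obtain ⟨x, rfl⟩ := S.mkQ_surjective z
    obtain ⟨y, hy⟩ := hsurj x
    refine ⟨S.mkQ y, ?_⟩
    simp only [q, Submodule.mkQ_apply, Submodule.mapQ_apply]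
    exact ((Submodule.Quotient.eq S).2 hy).symm
  have hi : Function.Injective q := LinearMap.injective_iff_surjective.2 hq
  have : q (S.mkQ v) = 0 := by
    simp only [q, Submodule.mkQ_apply, Submodule.mapQ_apply]
    exact (Submodule.Quotient.mk_eq_zero S).2 hv
  have h0 : S.mkQ v = 0 := hi (by rw [this, map_zero])
  exact (Submodule.Quotient.mk_eq_zero S).1 h0

/-- A root vector lying in `𝔱 + 𝔲` lies in `𝔲`. -/
theorem rootVector_mem_aux {k g : Type*} [Field k] [IsAlgClosed k] [CharZero k]
    [LieRing g] [LieAlgebra k g] [FiniteDimensional k g] [LieAlgebra.IsKilling k g]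
    (𝔱 𝔲 : LieSubalgebra k g) [𝔱.IsCartanSubalgebra]
    (hnil : ∀ x ∈ 𝔲, IsNilpotent (LieAlgebra.ad k g x))
    (α : 𝔱 → k) (hα : α ≠ 0) (x : g) (hx : x ∈ LieAlgebra.rootSpace 𝔱 α)
    (hxb : x ∈ 𝔱.toSubmodule ⊔ 𝔲.toSubmodule) : x ∈ 𝔲 := by
  obtain ⟨t, ht, u, hu, rfl⟩ := Submodule.mem_sup.1 hxb
  set x := t + u with hxdef
  have htx : ⁅t, x⁆ = α ⟨t, ht⟩ • x :=
    LieAlgebra.IsKilling.lie_eq_smul_of_mem_rootSpace hx ⟨t, ht⟩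
  have hux : ⁅u, x⁆ = -(α ⟨t, ht⟩) • x := by
    have : u = x - t := by simp [hxdef]
    rw [this, sub_lie, lie_self, htx]; simp
  by_cases hx0 : x = 0
  · rw [hx0]; exact 𝔲.zero_mem
  have hαt : α ⟨t, ht⟩ = 0 := by
    obtain ⟨n, hn⟩ := hnil u hu
    have hpow : ∀ m : ℕ, ((LieAlgebra.ad k g u) ^ m) x = (-(α ⟨t, ht⟩)) ^ m • x := by
      intro m
      induction m with
      | zero => simp
      | succ m ih =>
        rw [pow_succ', Module.End.mul_apply, ih, map_smul, LieAlgebra.ad_apply, hux, smul_smul,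
          pow_succ]
    have h := hpow n
    rw [hn, LinearMap.zero_apply] at h
    rcases smul_eq_zero.1 h.symm with h | h
    · simpa using eq_zero_of_pow_eq_zero h
    · exact absurd h hx0
  have hxn : IsNilpotent (LieAlgebra.ad k g x) :=
    LieAlgebra.isNilpotent_ad_of_mem_rootSpace 𝔱 hα hx
  have hcomm : Commute (LieAlgebra.ad k g x) (LieAlgebra.ad k g u) := by
    refine LinearMap.ext fun y => ?_
    have h0 : ⁅x, u⁆ = 0 := by rw [← lie_skew, hux, hαt]; simp
    have h1 := leibniz_lie x u y
    rw [h0, zero_lie, zero_add] at h1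
    simpa only [Module.End.mul_apply, LieAlgebra.ad_apply] using h1
  have htn : IsNilpotent (LieAlgebra.ad k g t) := by
    have : t = x - u := by simp [hxdef]
    rw [this, map_sub]
    exact hcomm.isNilpotent_sub hxn (hnil u hu)
  have ht0 : t = 0 :=
    LieAlgebra.IsKilling.eq_zero_of_isNilpotent_ad_of_mem_isCartanSubalgebra k g 𝔱 ht htn
  rw [hxdef, ht0, zero_add]; exact hu

/-- The nilpotent part `𝔲` is normalised by `𝔱`. -/
theorem lie_mem_aux {k g : Type*} [Field k] [IsAlgClosed k] [CharZero k]
    [LieRing g] [LieAlgebra k g] [FiniteDimensional k g] [LieAlgebra.IsKilling k g]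
    (𝔱 𝔲 : LieSubalgebra k g) [𝔱.IsCartanSubalgebra]
    (𝔟 : LieSubalgebra k g) (hb : 𝔟.toSubmodule = 𝔱.toSubmodule ⊔ 𝔲.toSubmodule)
    (hnil : ∀ x ∈ 𝔲, IsNilpotent (LieAlgebra.ad k g x))
    (t₀ : g) (ht₀ : t₀ ∈ 𝔱) (u : g) (hu : u ∈ 𝔲) : ⁅t₀, u⁆ ∈ 𝔲 := by
  have htb : ∀ x ∈ 𝔱, x ∈ 𝔟 := fun x hx => by
    have : x ∈ 𝔟.toSubmodule := by rw [hb]; exact Submodule.mem_sup_left hx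
    exact this
  have hub : ∀ x ∈ 𝔲, x ∈ 𝔟 := fun x hx => by
    have : x ∈ 𝔟.toSubmodule := by rw [hb]; exact Submodule.mem_sup_right hx
    exact this
  let B : LieSubmodule k 𝔱 g :=
    { 𝔟.toSubmodule with
      lie_mem := fun {x m} hm => 𝔟.lie_mem (htb x x.2) hm }
  have key : ∀ x ∈ B, ∃ t ∈ 𝔱, ∃ w ∈ 𝔲, x = t + w ∧ ⁅t₀, w⁆ ∈ 𝔲 := by
    intro x hx
    rw [LieModule.eq_iSup_inf_genWeightSpace k 𝔱 g B] at hx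
    induction hx using LieSubmodule.iSup_induction' with
    | mem χ x hx =>
      obtain ⟨hxB, hxχ⟩ := hx
      by_cases hχ : (χ : 𝔱 → k) = 0
      · refine ⟨x, ?_, 0, 𝔲.zero_mem, by simp, by simp [𝔲.zero_mem]⟩
        have h0 : x ∈ LieAlgebra.rootSpace 𝔱 (0 : 𝔱 → k) := by rw [← hχ]; exact hxχ
        rw [LieAlgebra.rootSpace_zero_eq] at h0
        exact h0
      · have hxu : x ∈ 𝔲 := rootVector_mem_aux 𝔱 𝔲 hnil χ hχ x hxχ (by rw [← hb]; exact hxB)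
        refine ⟨0, 𝔱.zero_mem, x, hxu, by simp, ?_⟩
        have := LieAlgebra.IsKilling.lie_eq_smul_of_mem_rootSpace hxχ ⟨t₀, ht₀⟩
        have h2 : ⁅t₀, x⁆ = χ ⟨t₀, ht₀⟩ • x := this
        rw [h2]; exact 𝔲.smul_mem _ hxu
    | zero => exact ⟨0, 𝔱.zero_mem, 0, 𝔲.zero_mem, by simp, by simp [𝔲.zero_mem]⟩
    | add x y _ _ ihx ihy =>
      obtain ⟨t, ht, w, hw, rfl, h⟩ := ihx
      obtain ⟨t', ht', w', hw', rfl, h'⟩ := ihy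
      refine ⟨t + t', 𝔱.add_mem ht ht', w + w', 𝔲.add_mem hw hw', by abel, ?_⟩
      rw [lie_add]; exact 𝔲.add_mem h h'
  obtain ⟨t, ht, w, hw, hutw, h⟩ := key u (hub u hu)
  have htu : t ∈ 𝔲 := by
    have : t = u - w := by rw [hutw]; abel
    rw [this]; exact 𝔲.sub_mem hu hw
  have ht0 : t = 0 :=
    LieAlgebra.IsKilling.eq_zero_of_isNilpotent_ad_of_mem_isCartanSubalgebra k g 𝔱 ht (hnil t htu)
  rw [hutw, ht0, zero_add]; exact h

/-- For regular `t₀`, one has `g = [t₀, g] + 𝔱`. -/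
theorem exists_sub_lie_mem_aux {k g : Type*} [Field k] [IsAlgClosed k] [CharZero k]
    [LieRing g] [LieAlgebra k g] [FiniteDimensional k g] [LieAlgebra.IsKilling k g]
    (𝔱 : LieSubalgebra k g) [𝔱.IsCartanSubalgebra]
    (t₀ : g) (ht₀ : t₀ ∈ 𝔱) (hreg : ∀ y : g, ⁅t₀, y⁆ = 0 → y ∈ 𝔱) (x : g) :
    ∃ y, x - ⁅t₀, y⁆ ∈ 𝔱 := by
  have hx : x ∈ (⊤ : LieSubmodule k 𝔱 g) := LieSubmodule.mem_top x
  rw [← LieModule.iSup_genWeightSpace_eq_top' k 𝔱 g] at hx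
  induction hx using LieSubmodule.iSup_induction' with
  | mem χ x hx =>
    have h2 : ⁅t₀, x⁆ = χ ⟨t₀, ht₀⟩ • x :=
      LieAlgebra.IsKilling.lie_eq_smul_of_mem_rootSpace hx ⟨t₀, ht₀⟩
    by_cases h : χ ⟨t₀, ht₀⟩ = 0
    · exact ⟨0, by simpa using hreg x (by rw [h2, h, zero_smul])⟩
    · refine ⟨(χ ⟨t₀, ht₀⟩)⁻¹ • x, ?_⟩
      rw [lie_smul, h2, smul_smul, inv_mul_cancel₀ h, one_smul, sub_self]
      exact 𝔱.zero_mem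
  | zero => exact ⟨0, by simp [𝔱.zero_mem]⟩
  | add x y _ _ ihx ihy =>
    obtain ⟨a, ha⟩ := ihx
    obtain ⟨b, hb⟩ := ihy
    refine ⟨a + b, ?_⟩
    have : x + y - ⁅t₀, a + b⁆ = (x - ⁅t₀, a⁆) + (y - ⁅t₀, b⁆) := by rw [lie_add]; abel
    rw [this]; exact 𝔱.add_mem ha hb

/-- The lower central series of `g` as a `𝔲`-module is stable under any `t₀` normalising `𝔲`. -/
theorem lie_mem_lcs_aux {k g : Type*} [Field k] [LieRing g] [LieAlgebra k g]
    (𝔲 : LieSubalgebra k g) (t₀ : g) (h : ∀ u ∈ 𝔲, ⁅t₀, u⁆ ∈ 𝔲) (n : ℕ) :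
    ∀ x ∈ LieModule.lowerCentralSeries k 𝔲 g n,
      ⁅t₀, x⁆ ∈ LieModule.lowerCentralSeries k 𝔲 g n := by
  induction n with
  | zero => intro x _; simp
  | succ n ih =>
    intro x hx
    rw [LieModule.lowerCentralSeries_succ, ← LieSubmodule.mem_toSubmodule,
      LieSubmodule.lieIdeal_oper_eq_linear_span'] at hx
    induction hx using Submodule.span_induction with
    | mem x hx =>
      obtain ⟨u, -, m, hm, rfl⟩ := hx
      have e : ⁅t₀, ⁅u, m⁆⁆ = ⁅(⟨⁅t₀, (u : g)⁆, h u u.2⟩ : 𝔲), m⁆ + ⁅u, ⁅t₀, m⁆⁆ :=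
        leibniz_lie t₀ (u : g) m
      rw [e, LieModule.lowerCentralSeries_succ]
      exact add_mem (LieSubmodule.lie_mem_lie (LieSubmodule.mem_top _) hm)
        (LieSubmodule.lie_mem_lie (LieSubmodule.mem_top _) (ih m hm))
    | zero => simp
    | add x y _ _ hx hy => rw [lie_add]; exact add_mem hx hy
    | smul c x _ hx => rw [lie_smul]; exact SMulMemClass.smul_mem c hx


/-- Let `g` be semisimple with triangular decomposition
`g = 𝔲 ⊕ 𝔱 ⊕ 𝔲⁻`, `𝔟 = 𝔲 ⊕ 𝔱` the Borel, and let `p₋ : g → 𝔲⁻` be the projection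
with kernel `𝔟`, so that the `𝔟`-action on `𝔲⁻ ≅ g/𝔟` is `b ∘ η = p₋ [b, η]`.
If `t₀ ∈ 𝔱` is regular (its centraliser in `g` is `𝔱`) and `u₀ ∈ 𝔲` is arbitrary,
then `(t₀ + u₀) ∘ 𝔲⁻ = 𝔲⁻`, i.e. the map `η ↦ p₋ [t₀ + u₀, η]` from `𝔲⁻` to `𝔲⁻`
is surjective. -/
theorem statement_6 {k g : Type*} [Field k] [IsAlgClosed k] [CharZero k]
    [LieRing g] [LieAlgebra k g] [FiniteDimensional k g]
    [LieAlgebra.IsSemisimple k g]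
    (𝔱 𝔲 : LieSubalgebra k g) [𝔱.IsCartanSubalgebra]
    (𝔟 : LieSubalgebra k g) (hb : 𝔟.toSubmodule = 𝔱.toSubmodule ⊔ 𝔲.toSubmodule)
    (hnil : ∀ x ∈ 𝔲, IsNilpotent (LieAlgebra.ad k g x))
    (𝔫 : Submodule k g)   -- the space 𝔲⁻
    (hcompl : IsCompl 𝔟.toSubmodule 𝔫)
    (pminus : g →ₗ[k] 𝔫)
    (hp : pminus = Submodule.linearProjOfIsCompl 𝔫 𝔟.toSubmodule hcompl.symm)
    (t₀ : g) (ht₀ : t₀ ∈ 𝔱) (hreg : ∀ y : g, ⁅t₀, y⁆ = 0 → y ∈ 𝔱)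
    (u₀ : g) (hu₀ : u₀ ∈ 𝔲) :
    Function.Surjective (fun η : 𝔫 => pminus ⁅t₀ + u₀, (η : g)⁆) := by
  haveI : LieAlgebra.IsKilling k g := inferInstance
  have htb : ∀ x ∈ 𝔱, x ∈ 𝔟 := fun x hx => by
    have : x ∈ 𝔟.toSubmodule := by rw [hb]; exact Submodule.mem_sup_left hx
    exact this
  have hub : ∀ x ∈ 𝔲, x ∈ 𝔟 := fun x hx => by
    have : x ∈ 𝔟.toSubmodule := by rw [hb]; exact Submodule.mem_sup_right hx
    exact this
  have hnorm : ∀ u ∈ 𝔲, ⁅t₀, u⁆ ∈ 𝔲 := lie_mem_aux 𝔱 𝔲 𝔟 hb hnil t₀ ht₀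
  have hN : LieModule.IsNilpotent 𝔲 g := by
    rw [LieModule.isNilpotent_iff_forall (R := k)]
    intro x
    exact hnil x x.2
  let F : 𝔫 →ₗ[k] 𝔫 := pminus ∘ₗ (LieAlgebra.ad k g (t₀ + u₀)) ∘ₗ 𝔫.subtype
  have hFs : Function.Surjective F := by
    rw [← LinearMap.injective_iff_surjective, ← LinearMap.ker_eq_bot, LinearMap.ker_eq_bot']
    intro v hv
    have hvb : ⁅t₀ + u₀, (v : g)⁆ ∈ 𝔟.toSubmodule := by
      have h : pminus ⁅t₀ + u₀, (v : g)⁆ = 0 := hv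
      rw [hp] at h
      exact (Submodule.linearProjOfIsCompl_apply_eq_zero_iff hcompl.symm).1 h
    have step : ∀ n : ℕ, (v : g) ∈ 𝔟.toSubmodule ⊔
        (LieModule.lowerCentralSeries k 𝔲 g n).toSubmodule := by
      intro n
      induction n with
      | zero => simp
      | succ n ih =>
        apply mem_of_apply_mem_aux (LieAlgebra.ad k g t₀)
        · intro x hx
          obtain ⟨b, hb', d, hd, rfl⟩ := Submodule.mem_sup.1 hx
          rw [map_add]
          exact Submodule.add_mem_sup (𝔟.lie_mem (htb _ ht₀) hb')
            (lie_mem_lcs_aux 𝔲 t₀ hnorm (n + 1) d hd)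
        · intro x
          obtain ⟨y, hy⟩ := exists_sub_lie_mem_aux 𝔱 t₀ ht₀ hreg x
          exact ⟨y, Submodule.mem_sup_left (htb _ hy)⟩
        · obtain ⟨b, hb', d, hd, hbd⟩ := Submodule.mem_sup.1 ih
          have e : LieAlgebra.ad k g t₀ (v : g) =
              (⁅t₀ + u₀, (v : g)⁆ - ⁅u₀, b⁆) + (-⁅u₀, d⁆) := by
            rw [LieAlgebra.ad_apply, ← hbd, add_lie, lie_add u₀]; abel
          rw [e]
          refine Submodule.add_mem_sup (Submodule.sub_mem _ hvb (𝔟.lie_mem (hub _ hu₀) hb'))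
            (Submodule.neg_mem _ ?_)
          rw [LieModule.lowerCentralSeries_succ]
          exact LieSubmodule.lie_mem_lie (x := (⟨u₀, hu₀⟩ : 𝔲)) (LieSubmodule.mem_top _) hd
    obtain ⟨n, hn⟩ := (LieModule.isNilpotent_iff k 𝔲 g).1 hN
    have hv' := step n
    rw [hn, LieSubmodule.bot_toSubmodule, sup_bot_eq] at hv'
    exact Subtype.ext (Submodule.disjoint_def.1 hcompl.disjoint _ hv' v.2)
  exact hFs
end

section
/- Define P̂_i ∈ k[q*] by P̂_i(u, ξ) = κ(P_i(u), ξ) for u ∈ u, ξ ∈ b⁻, where P_i = (grad f_i)|_u. Then each P̂_i is invariant under the coadjoint action of Q = B ⋉ N on q* = u ∝ b⁻. Moreover, N-invariance of a function of the form (u,ξ) ↦ κ(P(u),ξ) for a morphism P : u → b is equivalent to [P(u), u] = 0 for all u ∈ u. -/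
/-- Let `g` be semisimple with triangular decomposition
`g = 𝔲 ⊕ 𝔱 ⊕ 𝔲⁻`, `𝔟 = 𝔱 ⊕ 𝔲`, `𝔟⁻ = 𝔱 ⊕ 𝔲⁻`, and Killing form `κ`.  Identify
`q* = 𝔲 ∝ 𝔟⁻`.  Let `P : 𝔲 → 𝔟` be a morphism (e.g. `P = P_i = (grad f_i)|_𝔲`) and
define `P̂(u,ξ) = κ(P u, ξ)`.  Let `φ(u,η) ∈ 𝔟⁻` be determined by
`κ(b, φ(u,η)) = κ([b,u], η)` for `b ∈ 𝔟` (the moment-map shift giving the coadjoint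
action of `N = exp((𝔲⁻)ᵃ)`: `exp(η) ⋆ (u,ξ) = (u, ξ + φ(u,η))`).  Then:
(1) `P̂` is `N`-invariant **iff** `[P u, u] = 0` for all `u ∈ 𝔲`; and
(2) `P̂` is invariant under (the `B`-part of) the coadjoint action of `Q = B ⋉ N`:
for any group `B` acting on `g` by operators `ρ s` preserving `κ`, `𝔲` and `𝔟`, with
`P` equivariant and with the contragredient action `σ s` on `𝔟⁻` (characterised by
`κ(b, σ s ξ) = κ(ρ s⁻¹ b, ξ)`), one has `κ(P (ρ s u), σ s ξ) = κ(P u, ξ)`.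
Together (1) and (2) say each `P̂_i` is `Q`-invariant. -/
theorem statement_10 {k g : Type*} [Field k] [IsAlgClosed k] [CharZero k]
    [LieRing g] [LieAlgebra k g] [FiniteDimensional k g]
    [LieAlgebra.IsSemisimple k g]
    (𝔱 𝔲 𝔫 : LieSubalgebra k g) [𝔱.IsCartanSubalgebra]
    (hTU : ∀ t ∈ 𝔱, ∀ x ∈ 𝔲, ⁅t, x⁆ ∈ 𝔲) (hTN : ∀ t ∈ 𝔱, ∀ x ∈ 𝔫, ⁅t, x⁆ ∈ 𝔫)
    (hnilU : ∀ x ∈ 𝔲, IsNilpotent (LieAlgebra.ad k g x))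
    (hnilN : ∀ x ∈ 𝔫, IsNilpotent (LieAlgebra.ad k g x))
    (hκTU : ∀ t ∈ 𝔱, ∀ x ∈ 𝔲, killingForm k g t x = 0)
    (hκTN : ∀ t ∈ 𝔱, ∀ x ∈ 𝔫, killingForm k g t x = 0)
    (hκUU : ∀ x ∈ 𝔲, ∀ y ∈ 𝔲, killingForm k g x y = 0)
    (hκNN : ∀ x ∈ 𝔫, ∀ y ∈ 𝔫, killingForm k g x y = 0)
    (hdec : 𝔱.toSubmodule ⊔ (𝔲.toSubmodule ⊔ 𝔫.toSubmodule) = ⊤)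
    (P : g → g)
    (hPb : ∀ u ∈ 𝔲, P u ∈ 𝔱.toSubmodule ⊔ 𝔲.toSubmodule)
    (φ : g → g → g)
    (hφmem : ∀ u η, φ u η ∈ 𝔱.toSubmodule ⊔ 𝔫.toSubmodule)
    (hφ : ∀ u η b, b ∈ 𝔱.toSubmodule ⊔ 𝔲.toSubmodule →
      killingForm k g b (φ u η) = killingForm k g ⁅b, u⁆ η)
    (B : Type*) [Group B] (ρ σA : B →* Module.End k g)
    (hρκ : ∀ s x y, killingForm k g (ρ s x) (ρ s y) = killingForm k g x y)
    (hρu : ∀ s, ∀ u ∈ 𝔲, ρ s u ∈ 𝔲)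
    (hρb : ∀ s, ∀ b₀ ∈ 𝔱.toSubmodule ⊔ 𝔲.toSubmodule,
      ρ s b₀ ∈ 𝔱.toSubmodule ⊔ 𝔲.toSubmodule)
    (hσ : ∀ s, ∀ ξ ∈ 𝔱.toSubmodule ⊔ 𝔫.toSubmodule,
      ∀ b₀ ∈ 𝔱.toSubmodule ⊔ 𝔲.toSubmodule,
      killingForm k g b₀ (σA s ξ) = killingForm k g (ρ s⁻¹ b₀) ξ)
    (hPequiv : ∀ s, ∀ u ∈ 𝔲, P (ρ s u) = ρ s (P u)) :
    ((∀ u ∈ 𝔲, ∀ η ∈ 𝔫, ∀ ξ ∈ 𝔱.toSubmodule ⊔ 𝔫.toSubmodule,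
        killingForm k g (P u) (ξ + φ u η) = killingForm k g (P u) ξ) ↔
      (∀ u ∈ 𝔲, ⁅P u, u⁆ = 0)) ∧
    (∀ s : B, ∀ u ∈ 𝔲, ∀ ξ ∈ 𝔱.toSubmodule ⊔ 𝔫.toSubmodule,
      killingForm k g (P (ρ s u)) (σA s ξ) = killingForm k g (P u) ξ) := by
  have hnd : ∀ w : g, (∀ y, killingForm k g w y = 0) → w = 0 := by
    intro w hw
    have h : w ∈ LinearMap.ker (killingForm k g) := by
      rw [LinearMap.mem_ker]
      ext y
      simpa using hw y
    rw [LieAlgebra.IsKilling.ker_killingForm_eq_bot] at h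
    simpa using h
  refine ⟨⟨?_, ?_⟩, ?_⟩
  · intro h u hu
    have hw : ⁅P u, u⁆ ∈ 𝔲 := by
      obtain ⟨t, ht, x, hx, hP⟩ := Submodule.mem_sup.mp (hPb u hu)
      rw [← hP, add_lie]
      exact 𝔲.add_mem (hTU t ht u hu) (𝔲.lie_mem hx hu)
    apply hnd
    intro y
    have hy : y ∈ 𝔱.toSubmodule ⊔ (𝔲.toSubmodule ⊔ 𝔫.toSubmodule) := by
      rw [hdec]; trivial
    obtain ⟨t, ht, z, hz, rfl⟩ := Submodule.mem_sup.mp hy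
    obtain ⟨x, hx, n, hn, rfl⟩ := Submodule.mem_sup.mp hz
    have h1 : killingForm k g ⁅P u, u⁆ t = 0 := by
      have h0 := hκTU t ht _ hw
      rwa [LieModule.traceForm_comm] at h0
    have h2 : killingForm k g ⁅P u, u⁆ x = 0 := hκUU _ hw x hx
    have h3 : killingForm k g ⁅P u, u⁆ n = 0 := by
      rw [← hφ u n (P u) (hPb u hu)]
      have h0 := h u hu n hn 0 (Submodule.zero_mem _)
      simpa using h0
    rw [map_add, map_add, h1, h2, h3]
    simp
  · intro h u hu η _ ξ _
    rw [map_add, hφ u η (P u) (hPb u hu), h u hu]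
    simp
  · intro s u hu ξ hξ
    rw [hσ s ξ hξ _ (hPb _ (hρu s u hu)), hPequiv s u hu, ← Module.End.mul_apply, ← map_mul]
    simp
end

section
/- The index of the contracted Lie algebra q = b ⋉ (u⁻)ᵃ equals the rank l of the semisimple Lie algebra g: ind q = l, where ind q = dim q − max over x ∈ q* of dim(coadjoint orbit Q·x) = trdeg k(q*)^Q. -/
open LieAlgebra LieAlgebra.IsKilling LieModule Module

/-- Semicontinuity of the kernel dimension along a line. -/
lemma aux_semicont {k E F : Type*} [Field k] [AddCommGroup E] [Module k E]
    [AddCommGroup F] [Module k F] [FiniteDimensional k E]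
    (A B : E →ₗ[k] F) :
    {s : k | finrank k (LinearMap.ker A) < finrank k (LinearMap.ker (A + s • B))}.Finite := by
  obtain ⟨W, hW⟩ := Submodule.exists_isCompl (LinearMap.ker A)
  have hinj : LinearMap.ker (A ∘ₗ W.subtype) = ⊥ := by
    rw [LinearMap.ker_eq_bot']
    rintro ⟨x, hx⟩ h
    have : x ∈ LinearMap.ker A ⊓ W := ⟨by simpa using h, hx⟩
    rw [hW.inf_eq_bot] at this
    simpa using this
  obtain ⟨P, hP⟩ := LinearMap.exists_leftInverse_of_injective _ hinj
  have hP' : ∀ w : W, P (A w) = w := fun w => by simpa using LinearMap.congr_fun hP w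
  let C : Module.End k W := P ∘ₗ B ∘ₗ W.subtype
  have hfin : Set.Finite {μ : k | C.HasEigenvalue μ} := Module.End.finite_hasEigenvalue C
  refine (hfin.image (fun μ => -μ⁻¹)).subset ?_
  intro s hs
  simp only [Set.mem_ofPred_eq] at hs
  have hdim := Submodule.finrank_add_eq_of_isCompl hW
  have hne : LinearMap.ker (A + s • B) ⊓ W ≠ ⊥ := by
    intro h0
    have := Submodule.finrank_add_finrank_le_of_disjoint (disjoint_iff.mpr h0)
    omega
  obtain ⟨x, ⟨hx1, hxW⟩, hx0⟩ := Submodule.exists_mem_ne_zero_of_ne_bot hne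
  have hx2 : A x + s • B x = 0 := by simpa using hx1
  have h3 : (⟨x, hxW⟩ : W) + s • C ⟨x, hxW⟩ = 0 := by
    have := congrArg P hx2
    rw [map_add, map_smul, map_zero] at this
    rw [← this]
    congr 1
    exact (hP' ⟨x, hxW⟩).symm
  have hs0 : s ≠ 0 := by
    rintro rfl
    apply hx0
    simpa using h3
  refine ⟨-s⁻¹, ?_, by simp⟩
  refine Module.End.hasEigenvalue_of_hasEigenvector (x := ⟨x, hxW⟩) ?_
  rw [Module.End.hasEigenvector_iff, Module.End.mem_eigenspace_iff]
  refine ⟨?_, by simpa using hx0⟩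
  have : s • C ⟨x, hxW⟩ = - ⟨x, hxW⟩ := by
    rw [eq_neg_iff_add_eq_zero, add_comm]; exact h3
  rw [← inv_smul_smul₀ hs0 (C ⟨x, hxW⟩), this]
  simp

section Roots

variable {K L : Type*} [Field K] [CharZero K] [LieRing L] [LieAlgebra K L]
  [FiniteDimensional K L] [IsKilling K L] {H : LieSubalgebra K L} [H.IsCartanSubalgebra]
  [IsTriangularizable K H L]

lemma aux_lie_ne_zero (α β γ : Weight K H L) (hα : α.IsNonZero) (hβ : β.IsNonZero)
    (hγ : (γ : H → K) = α + β) {x y : L} (hx : x ∈ rootSpace H α) (hx0 : x ≠ 0)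
    (hy : y ∈ rootSpace H β) (hy0 : y ≠ 0) : ⁅x, y⁆ ≠ 0 := by
  obtain ⟨h, e, f, t, he, hf⟩ := exists_isSl2Triple_of_weight_isNonZero hα
  have hh : h = coroot α := t.h_eq_coroot hα he hf
  obtain ⟨z, hz, hz0⟩ := (chainTop α β).exists_ne_zero
  have hcoe : (chainTop α β : H → K) = chainTopCoeff α β • (α : H → K) + β := by
    rw [coe_chainTop, natCast_zsmul]
  have hc1 : 1 ≤ chainTopCoeff α β := by
    have := ((rootSpace_zsmul_add_ne_bot_iff α β hα 1).mp (by
      rw [one_smul, ← hγ]; exact γ.genWeightSpace_ne_bot)).1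
    exact_mod_cast this
  have hez : ⁅e, z⁆ = 0 := by
    have h1 : ⁅e, z⁆ ∈ rootSpace H (α + chainTop α β : H → K) :=
      lie_mem_genWeightSpace_of_mem_genWeightSpace he hz
    have h2 : rootSpace H (α + chainTop α β : H → K) = ⊥ := by
      by_contra hne
      have := ((rootSpace_zsmul_add_ne_bot_iff α β hα (chainTopCoeff α β + 1)).mp (by
        convert hne using 2
        rw [hcoe, add_smul, one_smul, natCast_zsmul]; abel)).1
      omega
    rw [h2] at h1
    simpa using h1
  have P : t.HasPrimitiveVectorWith z ((chainLength α β : ℕ) : K) :=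
    ⟨hz0, by rw [hh]; exact (chainLength_smul α β hz).symm, hez⟩
  have hcL := chainTopCoeff_le_chainLength α β
  obtain ⟨c, hc⟩ : ∃ c, chainTopCoeff α β = c + 1 := ⟨_, (Nat.sub_add_cancel hc1).symm⟩
  have hne1 := P.pow_toEnd_f_ne_zero_of_eq_nat rfl (i := c + 1) (by omega)
  have hne0 := P.pow_toEnd_f_ne_zero_of_eq_nat rfl (i := c) (by omega)
  have hfor := P.lie_e_pow_succ_toEnd_f c
  have hmem : ((toEnd K L L f) ^ (c+1)) z ∈ rootSpace H β := by
    have := toEnd_pow_apply_mem (χ₁ := (-α : H → K)) hf hz (c+1)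
    convert this using 2
    rw [hcoe, hc]; simp
  have h1 := finrank_rootSpace_eq_one β hβ
  obtain ⟨k1, hk1⟩ := (finrank_eq_one_iff_of_nonzero' (⟨_, hmem⟩ : rootSpace H β)
    (by simpa [Subtype.ext_iff] using hne1)).mp h1 ⟨y, hy⟩
  have h1' := finrank_rootSpace_eq_one α hα
  obtain ⟨k2, hk2⟩ := (finrank_eq_one_iff_of_nonzero' (⟨_, he⟩ : rootSpace H α)
    (by simpa [Subtype.ext_iff] using t.e_ne_zero)).mp h1' ⟨x, hx⟩
  have hk1' : k1 • ((toEnd K L L f) ^ (c+1)) z = y := congrArg Subtype.val hk1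
  have hk2' : k2 • e = x := congrArg Subtype.val hk2
  have hk10 : k1 ≠ 0 := by rintro rfl; apply hy0; rw [← hk1', zero_smul]
  have hk20 : k2 ≠ 0 := by rintro rfl; apply hx0; rw [← hk2', zero_smul]
  rw [← hk1', ← hk2', smul_lie, lie_smul, hfor]
  refine smul_ne_zero hk20 (smul_ne_zero hk10 (smul_ne_zero (mul_ne_zero ?_ ?_) hne0))
  · exact_mod_cast Nat.succ_ne_zero c
  · rw [sub_ne_zero]
    have : chainLength α β ≠ c := by omega
    exact_mod_cast this

end Roots

open RootPairing IsAddIndecomposable in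
lemma aux_base {ι R M N : Type*} [Finite ι] [Field R] [CharZero R] [AddCommGroup M]
    [AddCommGroup N] [Module R M] [Module R N] (P : RootPairing ι R M N) [P.IsRootSystem]
    [P.IsCrystallographic] [P.IsReduced] (S : Set ι)
    (h1 : ∀ i, i ∈ S ∨ P.reflectionPerm i i ∈ S)
    (h3 : ∀ i ∈ S, ∀ j ∈ S, P.pairingIn ℤ j i < 0 → P.reflectionPerm i j ∈ S)
    (h2 : ∀ i ∈ S, P.reflectionPerm i i ∉ S) :
    ∃ b : P.Base, (∀ i ∈ b.support, i ∈ S) ∧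
      ∀ i ∈ S, P.root i ∈ AddSubmonoid.closure (P.root '' b.support) := by
  classical
  have : Fintype ι := Fintype.ofFinite ι
  let T : Finset ι := Finset.univ.filter (· ∈ S)
  have hT : ∀ i, i ∈ T ↔ i ∈ S := by simp [T]
  have hsum : ∀ i ∈ S, 0 < ∑ j ∈ T, P.pairingIn ℤ i j := by
    intro i hi
    rw [← Finset.sum_filter_add_sum_filter_not T (fun j => P.reflectionPerm i j ∈ S)]
    have e1 : ∑ j ∈ T with P.reflectionPerm i j ∈ S, P.pairingIn ℤ i j = 0 := by
      have h : ∑ j ∈ T with P.reflectionPerm i j ∈ S, P.pairingIn ℤ i j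
        = ∑ j ∈ T with P.reflectionPerm i j ∈ S, - P.pairingIn ℤ i j := by
        refine Finset.sum_bij' (fun j _ => P.reflectionPerm i j) (fun j _ => P.reflectionPerm i j)
          ?_ ?_ ?_ ?_ ?_
        · intro j hj; simp_all
        · intro j hj; simp_all
        · intro j hj; simp
        · intro j hj; simp
        · intro j hj
          rw [pairingIn_reflectionPerm, pairingIn_reflectionPerm_self_left, neg_neg]
      rw [Finset.sum_neg_distrib] at h
      omega
    have e2 : 0 < ∑ j ∈ T with ¬ P.reflectionPerm i j ∈ S, P.pairingIn ℤ i j := by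
      refine Finset.sum_pos' ?_ ⟨i, ?_, by simp⟩
      · intro j hj
        simp only [Finset.mem_filter, hT] at hj
        by_contra hneg
        have h0 : P.pairingIn ℤ j i < 0 := by
          exact (P.pairingIn_lt_zero_iff ℤ).mp (not_le.mp hneg)
        exact hj.2 (h3 i hi j hj.1 h0)
      · simp only [Finset.mem_filter, hT]
        exact ⟨hi, h2 i hi⟩
    omega
  let _i : Module ℚ M := Module.compHom M (algebraMap ℚ R)
  obtain ⟨r, hr⟩ := LinearMap.exists_leftInverse_of_injective (Algebra.linearMap ℚ R)
    (LinearMap.ker_eq_bot.mpr (FaithfulSMul.algebraMap_injective ℚ R))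
  let f : M →+ ℚ := r.toAddMonoidHom.comp
    ((P.toLinearMap.flip (∑ j ∈ T, P.coroot j)).toAddMonoidHom)
  have hf : ∀ i, f (P.root i) = ((∑ j ∈ T, P.pairingIn ℤ i j : ℤ) : ℚ) := by
    intro i
    have : P.toLinearMap.flip (∑ j ∈ T, P.coroot j) (P.root i) =
        Algebra.linearMap ℚ R ((∑ j ∈ T, P.pairingIn ℤ i j : ℤ) : ℚ) := by
      simp [← P.algebraMap_pairingIn ℤ]
    change r (P.toLinearMap.flip (∑ j ∈ T, P.coroot j) (P.root i)) = _
    rw [this]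
    exact LinearMap.congr_fun hr _
  let := P.indexNeg
  have hpos : ∀ i ∈ S, 0 < f (P.root i) := by
    intro i hi
    rw [hf]
    exact_mod_cast hsum i hi
  have hnegroot : ∀ i, P.root (P.reflectionPerm i i) = - P.root i := by
    intro i; simp
  have hpos' : ∀ i, 0 < f (P.root i) → i ∈ S := by
    intro i hi
    rcases h1 i with h | h
    · exact h
    · have := hpos _ h
      rw [hnegroot, map_neg] at this
      linarith
  have hf0 : ∀ i, f (P.root i) ≠ 0 := by
    intro i
    rcases h1 i with h | h
    · exact (hpos i h).ne'
    · have := hpos _ h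
      rw [hnegroot, map_neg] at this
      linarith
  refine ⟨Base.mk' P (baseOf P.root f) (P.linearIndepOn_root_baseOf f hf0)
    (fun i ↦ mem_or_neg_mem_closure_baseOf P.root f i (hf0 i) (by simp)), ?_, ?_⟩
  · intro i hi
    have : i ∈ baseOf P.root f := by simpa [Base.mk'] using hi
    exact hpos' i this.1
  · intro i hi
    have e : (↑(Base.mk' P (baseOf P.root f) (P.linearIndepOn_root_baseOf f hf0)
      (fun i ↦ mem_or_neg_mem_closure_baseOf P.root f i (hf0 i) (by simp))).support : Set ι)
       = baseOf P.root f := by simp [Base.mk']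
    rw [e, AddSubmonoid.closure_image_isAddIndecomposable_baseOf]
    exact AddSubmonoid.subset_closure ⟨i, by simpa using hpos i hi, rfl⟩

section Roots

variable {K L : Type*} [Field K] [CharZero K] [LieRing L] [LieAlgebra K L]
  [FiniteDimensional K L] [IsKilling K L] {H : LieSubalgebra K L} [H.IsCartanSubalgebra]
  [IsTriangularizable K H L]

lemma aux_le (V : LieSubmodule K H L) (α : Weight K H L) (hα : α.IsNonZero) {x : L}
    (hx : x ∈ rootSpace H α) (hxV : x ∈ V) (hx0 : x ≠ 0) : rootSpace H α ≤ V := by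
  intro y hy
  obtain ⟨c, hc⟩ := (finrank_eq_one_iff_of_nonzero' (⟨_, hx⟩ : rootSpace H α)
    (by simpa [Subtype.ext_iff] using hx0)).mp (finrank_rootSpace_eq_one α hα) ⟨y, hy⟩
  have hc' : c • x = y := congrArg Subtype.val hc
  rw [← hc']
  exact V.smul_mem c hxV

lemma aux_or (U N : LieSubmodule K H L) (hspan : H.toLieSubmodule ⊔ U ⊔ N = ⊤)
    (α : Weight K H L) (hα : α.IsNonZero) : rootSpace H α ≤ U ∨ rootSpace H α ≤ N := by
  by_contra hcon
  push Not at hcon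
  let S : LieSubmodule K H L := ⨆ (χ : Weight K H L) (_ : χ ≠ α), genWeightSpace L χ
  have hdis : Disjoint (genWeightSpace L α) S := iSupIndep_genWeightSpace' K H L α
  have key : ∀ V : LieSubmodule K H L, V ⊓ genWeightSpace L α = ⊥ → V ≤ S := by
    intro V hV
    rw [eq_iSup_inf_genWeightSpace (K := K) (L := H) (M := L) V]
    refine iSup_le fun χ => ?_
    by_cases h : χ = α
    · rw [h, hV]; exact bot_le
    · exact inf_le_right.trans (le_iSup₂_of_le (f := fun (χ : Weight K H L) (_ : χ ≠ α) =>
        genWeightSpace L χ) χ h le_rfl)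
  have key2 : ∀ V : LieSubmodule K H L, ¬ rootSpace H α ≤ V → V ≤ S := by
    intro V hV
    refine key V ?_
    rw [LieSubmodule.eq_bot_iff]
    intro x hx
    by_contra hx0
    exact hV (aux_le V α hα ((LieSubmodule.mem_inf _ _ _).mp hx).2
      ((LieSubmodule.mem_inf _ _ _).mp hx).1 hx0)
  have hH : H.toLieSubmodule ≤ S := by
    refine key _ ?_
    rw [← rootSpace_zero_eq K L H]
    refine (disjoint_genWeightSpace K H L ?_).eq_bot
    intro h
    exact hα h.symm
  have htop : (⊤ : LieSubmodule K H L) ≤ S := by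
    rw [← hspan]
    exact sup_le (sup_le hH (key2 U hcon.1)) (key2 N hcon.2)
  have : genWeightSpace L α = ⊥ := by
    rw [← hdis.eq_bot, eq_comm, inf_eq_left]
    exact le_top.trans htop
  exact α.genWeightSpace_ne_bot' this

lemma aux_not (V : LieSubmodule K H L)
    (hVV : ∀ x ∈ V, ∀ y ∈ V, killingForm K L x y = 0) (α : Weight K H L)
    (h1 : rootSpace H α ≤ V) (h2 : rootSpace H (-α : H → K) ≤ V) : False := by
  obtain ⟨x, hx, hx0⟩ := α.exists_ne_zero
  apply hx0
  have := mem_ker_killingForm_of_mem_rootSpace_of_forall_rootSpace_neg K L H hx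
    (fun y hy => hVV _ (h1 hx) _ (h2 hy))
  simpa using this

lemma aux_refl (i j : H.root) :
    (((rootSystem H).reflectionPerm i j).1 : H → K) = j.1 - (j.1 (coroot i.1)) • (i.1 : H → K) := by
  have := (rootSystem H).root_reflectionPerm i j
  rw [RootPairing.reflection_apply_root] at this
  ext x
  have h2 := LinearMap.congr_fun this x
  rw [rootSystem_root_apply] at h2
  simpa using h2

lemma aux_string (U : LieSubmodule K H L) (hUU : ∀ x ∈ U, ∀ y ∈ U, ⁅x, y⁆ ∈ U)
    (hHU : ∀ x ∈ H, x ∈ U → x = 0) (α β : Weight K H L) (hα : α.IsNonZero)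
    (h1 : rootSpace H α ≤ U) (h2 : rootSpace H β ≤ U) (m : ℕ) (hm : m ≤ chainTopCoeff α β) :
    ∃ x ∈ rootSpace H (m • (α : H → K) + β), x ∈ U ∧ x ≠ 0 := by
  induction m with
  | zero =>
    obtain ⟨x, hx, hx0⟩ := β.exists_ne_zero
    exact ⟨x, by simpa using hx, h2 hx, hx0⟩
  | succ m ih =>
    obtain ⟨y, hy, hyU, hy0⟩ := ih (by omega)
    have wt : ∀ j : ℕ, j ≤ chainTopCoeff α β → rootSpace H (j • (α : H → K) + β) ≠ ⊥ := by
      intro j hj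
      have := (rootSpace_zsmul_add_ne_bot_iff α β hα j).mpr ⟨by omega, by omega⟩
      simpa using this
    let β' : Weight K H L := ⟨_, wt m (by omega)⟩
    let γ : Weight K H L := ⟨_, wt (m + 1) hm⟩
    have hβ' : β'.IsNonZero := by
      intro h
      have h0 : (m • (α : H → K) + β) = 0 := h
      rw [h0, rootSpace_zero_eq] at hy
      exact hy0 (hHU y (by simpa using hy) hyU)
    obtain ⟨x, hx, hx0⟩ := α.exists_ne_zero
    have hγ : (γ : H → K) = α + β' := by
      change (m + 1) • (α : H → K) + β = α + (m • (α : H → K) + β)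
      rw [add_smul, one_smul]; abel
    refine ⟨⁅x, y⁆, ?_, hUU _ (h1 hx) _ hyU,
      aux_lie_ne_zero α β' γ hα hβ' hγ hx hx0 hy hy0⟩
    have := lie_mem_genWeightSpace_of_mem_genWeightSpace hx hy
    change _ ∈ rootSpace H (γ : H → K)
    rw [hγ]; exact this

lemma aux_posbase (U N : LieSubmodule K H L) (hUU : ∀ x ∈ U, ∀ y ∈ U, ⁅x, y⁆ ∈ U)
    (hHU : ∀ x ∈ H, x ∈ U → x = 0)
    (hspan : H.toLieSubmodule ⊔ U ⊔ N = ⊤)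
    (hκU : ∀ x ∈ U, ∀ y ∈ U, killingForm K L x y = 0)
    (hκN : ∀ x ∈ N, ∀ y ∈ N, killingForm K L x y = 0) :
    ∃ b : (rootSystem H).Base, (∀ i ∈ b.support, rootSpace H i.1 ≤ U) ∧
      ∀ i : H.root, rootSpace H i.1 ≤ U →
        (rootSystem H).root i ∈ AddSubmonoid.closure ((rootSystem H).root '' b.support) := by
  have hnz : ∀ i : H.root, i.1.IsNonZero := fun i => LieSubalgebra.isNonZero_coe_root i
  have hneg : ∀ i : H.root, (((rootSystem H).reflectionPerm i i).1 : H → K) = -(i.1 : H → K) := by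
    intro i
    rw [aux_refl, root_apply_coroot (hnz i), two_smul]; abel
  refine aux_base (rootSystem H) {i | rootSpace H i.1 ≤ U} ?_ ?_ ?_
  · intro i
    change rootSpace H i.1 ≤ U ∨ rootSpace H (((rootSystem H).reflectionPerm i i).1 : H → K) ≤ U
    by_contra hcon
    push Not at hcon
    have h1 := (aux_or U N hspan i.1 (hnz i)).resolve_left hcon.1
    have h2 := (aux_or U N hspan _ (hnz ((rootSystem H).reflectionPerm i i))).resolve_left hcon.2
    rw [hneg] at h2
    exact aux_not N hκN i.1 h1 h2
  · intro i hi j hj hlt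
    change rootSpace H i.1 ≤ U at hi
    change rootSpace H j.1 ≤ U at hj
    change rootSpace H (((rootSystem H).reflectionPerm i j).1 : H → K) ≤ U
    have hp : j.1 (coroot i.1) = (((rootSystem H).pairingIn ℤ j i : ℤ) : K) := by
      have := (rootSystem H).algebraMap_pairingIn ℤ j i
      simpa using this.symm
    have hc := apply_coroot_eq_cast i.1 j.1
    rw [hp] at hc
    have hc' : (rootSystem H).pairingIn ℤ j i = (chainBotCoeff i.1 j.1 : ℤ) - chainTopCoeff i.1 j.1 := by
      exact_mod_cast hc
    obtain ⟨n, hn⟩ : ∃ n : ℕ, (rootSystem H).pairingIn ℤ j i = -(n : ℤ) :=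
      ⟨((rootSystem H).pairingIn ℤ j i).natAbs, by omega⟩
    obtain ⟨x, hx, hxU, hx0⟩ := aux_string U hUU hHU i.1 j.1 (hnz i) hi hj n (by omega)
    have he : n • (i.1 : H → K) + j.1 = (((rootSystem H).reflectionPerm i j).1 : H → K) := by
      rw [aux_refl, hp, hn]
      push_cast
      rw [neg_smul, sub_neg_eq_add, add_comm, Nat.cast_smul_eq_nsmul]
    rw [he] at hx
    exact aux_le U _ (hnz _) hx hxU hx0
  · intro i hi hi'
    change rootSpace H (((rootSystem H).reflectionPerm i i).1 : H → K) ≤ U at hi'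
    rw [hneg] at hi'
    exact aux_not U hκU i.1 hi hi'

end Roots

section Roots

variable {K L : Type*} [Field K] [CharZero K] [LieRing L] [LieAlgebra K L]
  [FiniteDimensional K L] [IsKilling K L] {H : LieSubalgebra K L} [H.IsCartanSubalgebra]
  [IsTriangularizable K H L]

lemma aux_eig (V : LieSubmodule K H L) (hHV : ∀ x ∈ H, x ∈ V → x = 0) (h : H) (p : K → Prop)
    (hp : ∀ α : Weight K H L, α.IsNonZero → rootSpace H α ≤ V → p (α h))
    (x : L) (hxV : x ∈ V) (hx0 : x ≠ 0) (μ : K) (hx : ⁅(h : L), x⁆ = μ • x) : p μ := by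
  by_contra hμ
  let A : Module.End K L := ad K L (h : L)
  have hle : V.toSubmodule ≤ ⨆ (ν : K) (_ : ν ≠ μ), A.eigenspace ν := by
    rw [eq_iSup_inf_genWeightSpace (K := K) (L := H) (M := L) V, LieSubmodule.iSup_toSubmodule]
    refine iSup_le fun χ => ?_
    by_cases hbot : ∃ y ∈ V ⊓ genWeightSpace L χ, y ≠ 0
    · obtain ⟨y, hy, hy0⟩ := hbot
      obtain ⟨hyV, hyχ⟩ := (LieSubmodule.mem_inf _ _ _).mp hy
      have hχ : χ.IsNonZero := by
        intro h
        have h0 : (χ : H → K) = 0 := h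
        rw [h0] at hyχ
        have hyH : y ∈ rootSpace H (0 : H → K) := hyχ
        rw [rootSpace_zero_eq] at hyH
        exact hy0 (hHV y (by simpa using hyH) hyV)
      have hpχ := hp χ hχ (aux_le V χ hχ hyχ hyV hy0)
      have hne : χ h ≠ μ := by rintro rfl; exact hμ hpχ
      refine le_trans ?_ (le_iSup₂_of_le (f := fun (ν : K) (_ : ν ≠ μ) => A.eigenspace ν)
        (χ h) hne le_rfl)
      intro z hz
      rw [Module.End.mem_eigenspace_iff]
      exact lie_eq_smul_of_mem_rootSpace ((LieSubmodule.mem_inf _ _ _).mp hz).2 h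
    · push Not at hbot
      intro z hz
      rw [hbot z hz]
      exact Submodule.zero_mem _
  have hdis := (Module.End.eigenspaces_iSupIndep A) μ
  have hxe : x ∈ A.eigenspace μ := by
    rw [Module.End.mem_eigenspace_iff]; exact hx
  exact hx0 (Submodule.disjoint_def.mp hdis x hxe (hle hxV))

lemma aux_principal (U N : LieSubmodule K H L) (hUU : ∀ x ∈ U, ∀ y ∈ U, ⁅x, y⁆ ∈ U)
    (hHU : ∀ x ∈ H, x ∈ U → x = 0) (hHN : ∀ x ∈ H, x ∈ N → x = 0)
    (hspan : H.toLieSubmodule ⊔ U ⊔ N = ⊤)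
    (hκU : ∀ x ∈ U, ∀ y ∈ U, killingForm K L x y = 0)
    (hκN : ∀ x ∈ N, ∀ y ∈ N, killingForm K L x y = 0) :
    ∃ h ∈ H, ∃ e ∈ U, ∃ f : L, ⁅e, f⁆ = h ∧ ⁅h, e⁆ = 2 • e ∧ ⁅h, f⁆ = -(2 • f) ∧
      (∀ x ∈ U, x ≠ 0 → ∀ μ : K, ⁅h, x⁆ = μ • x → ∃ m : ℕ, μ = 2 * (m + 1)) ∧
      (∀ x ∈ N, x ≠ 0 → ∀ μ : K, ⁅h, x⁆ = μ • x → ∃ m : ℕ, μ = -(2 * (m + 1))) := by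
  classical
  obtain ⟨b, hb1, hb2⟩ := aux_posbase U N hUU hHU hspan hκU hκN
  have hnz : ∀ i : H.root, i.1.IsNonZero := fun i => LieSubalgebra.isNonZero_coe_root i
  obtain ⟨h, hh⟩ := (Module.evalEquiv K H).surjective
    (b.toWeightBasis.constr K (fun _ => (2 : K)))
  have hδ : ∀ i ∈ b.support, i.1 h = 2 := by
    intro i hi
    have := LinearMap.congr_fun hh ((rootSystem H).root i)
    have h2 : (b.toWeightBasis.constr K (fun _ => (2 : K))) ((rootSystem H).root i) = 2 := by
      have := b.toWeightBasis.constr_basis K (fun _ => (2 : K)) ⟨i, hi⟩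
      rwa [b.toWeightBasis_apply] at this
    rw [h2] at this
    simpa using this
  let c : b.support → K := fun i => b.toCoweightBasis.repr h i
  have hc : h = ∑ i, c i • coroot i.1.1 := by
    conv_lhs => rw [← b.toCoweightBasis.sum_repr h]
    simp [c]
  have hsl : ∀ i : H.root, ∃ e f : L, ⁅e, f⁆ = (coroot i.1 : L) ∧ e ∈ rootSpace H i.1 ∧
      f ∈ rootSpace H (-i.1 : H → K) := by
    intro i
    obtain ⟨h', e, f, t, he, hf⟩ := exists_isSl2Triple_of_weight_isNonZero (hnz i)
    exact ⟨e, f, by rw [t.lie_e_f, t.h_eq_coroot (hnz i) he hf], he, hf⟩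
  choose e f hef he hf using hsl
  have horth : ∀ i ∈ b.support, ∀ j ∈ b.support, i ≠ j → ⁅e i, f j⁆ = 0 := by
    intro i hi j hj hij
    have h1 : ⁅e i, f j⁆ ∈ rootSpace H (i.1 + -j.1 : H → K) :=
      lie_mem_genWeightSpace_of_mem_genWeightSpace (he i) (hf j)
    by_contra hne
    have h2 : rootSpace H (i.1 + -j.1 : H → K) ≠ ⊥ := by
      intro h0
      rw [h0] at h1
      exact hne (by simpa using h1)
    let χ : Weight K H L := ⟨_, h2⟩
    have hχe : (χ : H → K) = i.1 + -j.1 := rfl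
    have hχ : χ.IsNonZero := by
      intro h0
      have h0' : (i.1 + -j.1 : H → K) = 0 := h0
      apply hij
      apply Subtype.ext
      apply DFunLike.coe_injective
      rw [← sub_eq_add_neg, sub_eq_zero] at h0'
      exact h0'
    refine b.sub_notMem_range_root hi hj ⟨⟨χ, by simpa using hχ⟩, ?_⟩
    ext z
    simp [hχe, sub_eq_add_neg]
  have hpos : ∀ α : Weight K H L, α.IsNonZero → rootSpace H α ≤ U →
      ∃ m : ℕ, α h = 2 * (m + 1) := by
    intro α hα hαU
    let i : H.root := ⟨α, by simpa using hα⟩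
    have hmem := hb2 i hαU
    have : ∀ φ ∈ AddSubmonoid.closure ((rootSystem H).root '' b.support),
        φ = 0 ∨ ∃ m : ℕ, φ h = 2 * (m + 1) := by
      intro φ hφ
      induction hφ using AddSubmonoid.closure_induction with
      | mem x hx =>
        obtain ⟨j, hj, rfl⟩ := hx
        exact Or.inr ⟨0, by simpa using hδ j hj⟩
      | zero => exact Or.inl rfl
      | add x y _ _ hx hy =>
        rcases hx with rfl | ⟨m, hm⟩
        · simpa using hy
        · rcases hy with rfl | ⟨n, hn⟩
          · exact Or.inr ⟨m, by simpa using hm⟩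
          · refine Or.inr ⟨m + n + 1, ?_⟩
            rw [LinearMap.add_apply, hm, hn]; push_cast; ring
    rcases this _ hmem with h0 | ⟨m, hm⟩
    · exact absurd h0 ((rootSystem H).ne_zero i)
    · exact ⟨m, by simpa [i] using hm⟩
  have hneg : ∀ α : Weight K H L, α.IsNonZero → rootSpace H α ≤ N →
      ∃ m : ℕ, α h = -(2 * (m + 1)) := by
    intro α hα hαN
    have hnα : (-α).IsNonZero := by simpa using hα
    rcases aux_or U N hspan (-α) hnα with h1 | h1
    · obtain ⟨m, hm⟩ := hpos (-α) hnα h1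
      refine ⟨m, ?_⟩
      rw [← hm]; simp
    · exact (aux_not N hκN α hαN (by simpa using h1)).elim
  refine ⟨h, h.2, ∑ i : b.support, e i, ?_, ∑ i : b.support, c i • f i, ?_, ?_, ?_, ?_, ?_⟩
  · exact Submodule.sum_mem U.toSubmodule fun i _ => hb1 i i.2 (he i)
  · have hcL : (h : L) = ∑ i, c i • (coroot i.1.1 : L) := by
      conv_lhs => rw [hc]
      simp
    rw [hcL, sum_lie]
    refine Finset.sum_congr rfl fun i _ => ?_
    rw [lie_sum, Finset.sum_eq_single i]
    · rw [lie_smul, hef]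
    · intro j _ hji
      rw [lie_smul, horth i i.2 j j.2 (fun h => hji (Subtype.ext h.symm)), smul_zero]
    · simp
  · rw [lie_sum, Finset.smul_sum]
    refine Finset.sum_congr rfl fun i _ => ?_
    have := lie_eq_smul_of_mem_rootSpace (he i) h
    rw [hδ i i.2] at this
    rw [← ofNat_smul_eq_nsmul K 2 (e i)]
    exact this
  · rw [lie_sum, Finset.smul_sum, ← Finset.sum_neg_distrib]
    refine Finset.sum_congr rfl fun i _ => ?_
    have := lie_eq_smul_of_mem_rootSpace (hf i) h
    rw [Pi.neg_apply, hδ i i.2] at this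
    rw [lie_smul, ← ofNat_smul_eq_nsmul K 2 (c i • f i), smul_comm, ← smul_neg, ← neg_smul]
    exact congrArg _ this
  · intro x hx hx0 μ hμ
    exact aux_eig U hHU h (fun μ => ∃ m : ℕ, μ = 2 * (m + 1)) hpos x hx hx0 μ hμ
  · intro x hx hx0 μ hμ
    exact aux_eig N hHN h (fun μ => ∃ m : ℕ, μ = -(2 * (m + 1))) hneg x hx hx0 μ hμ

end Roots

section Lin

variable {k g : Type*} [Field k] [CharZero k] [LieRing g] [LieAlgebra k g]
  [FiniteDimensional k g]

lemma aux_key [IsAlgClosed k] (U N : Submodule k g) (h e f : g) (hef : ⁅e, f⁆ = h)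
    (hhe : ⁅h, e⁆ = 2 • e) (hhf : ⁅h, f⁆ = -(2 • f))
    (hU : ∀ x ∈ U, ⁅h, x⁆ ∈ U) (hN : ∀ x ∈ N, ⁅h, x⁆ ∈ N)
    (hUe : ∀ x ∈ U, x ≠ 0 → ∀ μ : k, ⁅h, x⁆ = μ • x → ∃ m : ℕ, μ = 2 * (m + 1))
    (hNe : ∀ x ∈ N, x ≠ 0 → ∀ μ : k, ⁅h, x⁆ = μ • x → ∃ m : ℕ, μ = -(2 * (m + 1)))
    (η : g) (hη : η ∈ N) (heη : ⁅e, η⁆ ∈ U) : η = 0 := by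
  by_contra hη0
  let W : Submodule k g := N ⊓ U.comap (ad k g e : g →ₗ[k] g)
  have hWmem : ∀ x : g, x ∈ W ↔ x ∈ N ∧ ⁅e, x⁆ ∈ U := fun x => Iff.rfl
  have hcomm : ∀ x : g, ⁅e, ⁅h, x⁆⁆ = ⁅h, ⁅e, x⁆⁆ - 2 • ⁅e, x⁆ := by
    intro x
    rw [← nsmul_lie, ← hhe, lie_lie]; abel
  have hWs : ∀ x ∈ W, (ad k g h : g →ₗ[k] g) x ∈ W := by
    intro x hx
    rw [hWmem] at hx ⊢
    refine ⟨hN x hx.1, ?_⟩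
    change ⁅e, ⁅h, x⁆⁆ ∈ U
    rw [hcomm]
    exact U.sub_mem (hU _ hx.2) (U.smul_of_tower_mem 2 hx.2)
  have : Nontrivial W := ⟨⟨η, (hWmem η).mpr ⟨hη, heη⟩⟩, 0, by simpa [Subtype.ext_iff] using hη0⟩
  obtain ⟨μ, hμ⟩ := Module.End.exists_eigenvalue ((ad k g h : g →ₗ[k] g).restrict hWs)
  obtain ⟨⟨y, hyW⟩, hy⟩ := hμ.exists_hasEigenvector
  have hy0 : y ≠ 0 := by simpa [Subtype.ext_iff] using hy.2
  have hyμ : ⁅h, y⁆ = μ • y := congrArg Subtype.val hy.apply_eq_smul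
  rw [hWmem] at hyW
  obtain ⟨m, hm⟩ := hNe y hyW.1 hy0 μ hyμ
  have hey : ⁅e, y⁆ = 0 := by
    by_contra hne
    have h1 : ⁅h, ⁅e, y⁆⁆ = (μ + 2) • ⁅e, y⁆ := by
      have := hcomm y
      rw [hyμ, lie_smul, ← ofNat_smul_eq_nsmul k 2, eq_sub_iff_add_eq] at this
      rw [← this, add_smul]
    obtain ⟨n, hn⟩ := hUe _ hyW.2 hne _ h1
    rw [hm] at hn
    have h3 : ((2 * (n + 1) + 2 * (m + 1) : ℕ) : k) = (2 : ℕ) := by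
      push_cast; linear_combination -hn
    have := Nat.cast_injective h3
    omega
  have hμ0 : μ ≠ 0 := by
    rw [hm, neg_ne_zero]
    exact_mod_cast (by omega : 2 * (m + 1) ≠ 0)
  have t : IsSl2Triple h e f := ⟨by
    rintro rfl
    rw [zero_lie] at hyμ
    rcases smul_eq_zero.mp hyμ.symm with h | h
    · exact hμ0 h
    · exact hy0 h, hef, hhe, hhf⟩
  have P : t.HasPrimitiveVectorWith y μ := ⟨hy0, hyμ, hey⟩
  obtain ⟨n, hn⟩ := P.exists_nat
  rw [hm] at hn
  have h3 : ((n + 2 * (m + 1) : ℕ) : k) = (0 : ℕ) := by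
    push_cast; linear_combination -hn
  have := Nat.cast_injective h3
  omega

end Lin

section Bil

variable {k g : Type*} [Field k] [AddCommGroup g] [Module k g] [FiniteDimensional k g]

lemma aux_zero (κ : g →ₗ[k] g →ₗ[k] k) (hnd : ∀ x, (∀ y, κ x y = 0) → x = 0)
    (T U N : Submodule k g) (hspan : T ⊔ U ⊔ N = ⊤) (x : g)
    (h1 : ∀ y ∈ T, κ x y = 0) (h2 : ∀ y ∈ U, κ x y = 0) (h3 : ∀ y ∈ N, κ x y = 0) : x = 0 := by
  refine hnd x fun y => ?_
  have hy : y ∈ T ⊔ U ⊔ N := by rw [hspan]; trivial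
  obtain ⟨z, hz, n, hn, rfl⟩ := Submodule.mem_sup.mp hy
  obtain ⟨t, ht, u, hu, rfl⟩ := Submodule.mem_sup.mp hz
  rw [map_add, map_add, h1 t ht, h2 u hu, h3 n hn]; simp

lemma aux_dual (κ : g →ₗ[k] g →ₗ[k] k) (hsymm : ∀ x y, κ x y = κ y x)
    (hnd : ∀ x, (∀ y, κ x y = 0) → x = 0)
    (T U N : Submodule k g) (hspan : T ⊔ U ⊔ N = ⊤)
    (hTU : ∀ t ∈ T, ∀ x ∈ U, κ t x = 0) (hTN : ∀ t ∈ T, ∀ x ∈ N, κ t x = 0)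
    (hUU : ∀ x ∈ U, ∀ y ∈ U, κ x y = 0) (hNN : ∀ x ∈ N, ∀ y ∈ N, κ x y = 0) :
    (∀ φ : Dual k N, ∃ e ∈ U, ∀ η : N, φ η = κ e η) ∧
    (∀ φ : Dual k U, ∃ η ∈ N, ∀ x : U, φ x = κ x η) ∧
    (∀ y, (∀ t ∈ T, κ t y = 0) → (∀ u ∈ U, κ u y = 0) → y ∈ U) := by
  have zero := aux_zero κ hnd T U N hspan
  let p : U →ₗ[k] Dual k N := κ.compl₁₂ U.subtype N.subtype
  let q : N →ₗ[k] Dual k U := κ.compl₁₂ N.subtype U.subtype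
  have hp : Function.Injective p := by
    rw [injective_iff_map_eq_zero]
    rintro ⟨x, hx⟩ h
    apply Subtype.ext
    refine zero x (fun y hy => ?_) (fun y hy => hUU x hx y hy) (fun y hy => ?_)
    · rw [hsymm]; exact hTU y hy x hx
    · exact LinearMap.congr_fun h ⟨y, hy⟩
  have hq : Function.Injective q := by
    rw [injective_iff_map_eq_zero]
    rintro ⟨x, hx⟩ h
    apply Subtype.ext
    refine zero x (fun y hy => ?_) (fun y hy => ?_) (fun y hy => hNN x hx y hy)
    · rw [hsymm]; exact hTN y hy x hx
    · exact LinearMap.congr_fun h ⟨y, hy⟩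
  have d1 := LinearMap.finrank_le_finrank_of_injective hp
  have d2 := LinearMap.finrank_le_finrank_of_injective hq
  rw [Subspace.dual_finrank_eq] at d1 d2
  have hps : Function.Surjective p :=
    (LinearMap.injective_iff_surjective_of_finrank_eq_finrank
      (by rw [Subspace.dual_finrank_eq]; omega)).mp hp
  have hqs : Function.Surjective q :=
    (LinearMap.injective_iff_surjective_of_finrank_eq_finrank
      (by rw [Subspace.dual_finrank_eq]; omega)).mp hq
  refine ⟨fun φ => ?_, fun φ => ?_, fun y hyT hyU => ?_⟩
  · obtain ⟨e, rfl⟩ := hps φ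
    exact ⟨e, e.2, fun η => rfl⟩
  · obtain ⟨e, rfl⟩ := hqs φ
    exact ⟨e, e.2, fun x => hsymm _ _⟩
  · have hy : y ∈ T ⊔ U ⊔ N := by rw [hspan]; trivial
    obtain ⟨z, hz, n, hn, rfl⟩ := Submodule.mem_sup.mp hy
    obtain ⟨t, ht, u, hu, rfl⟩ := Submodule.mem_sup.mp hz
    have hn0 : n = 0 := by
      refine zero n (fun y hy => ?_) (fun y hy => ?_) (fun y hy => hNN _ hn _ hy)
      · rw [hsymm]; exact hTN y hy n hn
      · have := hyU y hy
        rw [map_add, map_add, hUU y hy u hu, hsymm y t, hTU t ht y hy, zero_add, zero_add] at this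
        rw [hsymm]; exact this
    have ht0 : t = 0 := by
      refine zero t (fun y hy => ?_) (fun y hy => hTU t ht y hy) (fun y hy => hTN t ht y hy)
      have := hyT y hy
      rw [map_add, map_add, hTU y hy u hu, hTN y hy n hn, add_zero, add_zero] at this
      rw [hsymm]; exact this
    rw [hn0, ht0]
    simpa using hu

end Bil

section Lower

variable {k g : Type*} [Field k] [LieRing g] [LieAlgebra k g] [FiniteDimensional k g]

lemma aux_lower (κ : g →ₗ[k] g →ₗ[k] k) (B U N : Submodule k g) (hUB : U ≤ B)
    (hBB : ∀ x ∈ B, ∀ y ∈ B, ⁅x, y⁆ ∈ U)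
    (hdual : ∀ φ : Dual k U, ∃ η ∈ N, ∀ x : U, φ x = κ x η)
    (x : g) (hx : x ∈ B) (hinj : ∀ y ∈ U, ⁅x, y⁆ = 0 → y = 0) (δ : Dual k g)
    (F : (B × N) →ₗ[k] (B × N) →ₗ[k] k)
    (hF : ∀ p q, F p q = δ ⁅(p.1 : g), (q.1 : g)⁆ + κ ⁅x, (p.1 : g)⁆ q.2 - κ ⁅x, (q.1 : g)⁆ p.2)
    (l : ℕ) (hl : l + finrank k U = finrank k B) : l ≤ finrank k (LinearMap.ker F) := by
  let A : B →ₗ[k] U := ((ad k g x : g →ₗ[k] g) ∘ₗ B.subtype).codRestrict U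
    (fun b => hBB x hx b b.2)
  have hA : ∀ b : B, (A b : g) = ⁅x, (b : g)⁆ := fun b => rfl
  have hsurj : Function.Surjective A := by
    have h1 : Function.Injective (A ∘ₗ Submodule.inclusion hUB) := by
      rw [injective_iff_map_eq_zero]
      intro y hy
      apply Subtype.ext
      exact hinj y y.2 (congrArg Subtype.val hy)
    have h2 := LinearMap.injective_iff_surjective.mp h1
    intro y
    obtain ⟨z, hz⟩ := h2 y
    exact ⟨_, hz⟩
  have hker : finrank k (LinearMap.ker A) = l := by
    have := A.finrank_range_add_finrank_ker
    rw [LinearMap.range_eq_top.mpr hsurj, finrank_top] at this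
    omega
  rw [← hker]
  refine le_trans (Submodule.finrank_mono (t := (LinearMap.ker F).map (LinearMap.fst k B N)) ?_)
    (Submodule.finrank_map_le _ _)
  intro a ha
  have ha0 : ⁅x, (a : g)⁆ = 0 := congrArg Subtype.val (LinearMap.mem_ker.mp ha)
  let ψ : Dual k B := δ ∘ₗ (ad k g (a : g) : g →ₗ[k] g) ∘ₗ B.subtype
  have hψ : ψ ∈ LinearMap.range A.dualMap := by
    rw [LinearMap.range_dualMap_eq_dualAnnihilator_ker, Submodule.mem_dualAnnihilator]
    intro b hb
    have hb0 : ⁅x, (b : g)⁆ = 0 := congrArg Subtype.val (LinearMap.mem_ker.mp hb)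
    have : ⁅(a : g), (b : g)⁆ = 0 := by
      refine hinj _ (hBB _ a.2 _ b.2) ?_
      rw [leibniz_lie, ha0, hb0]; simp
    change δ ⁅(a : g), (b : g)⁆ = 0
    rw [this, map_zero]
  obtain ⟨φ, hφ⟩ := hψ
  obtain ⟨η, hη, hηφ⟩ := hdual φ
  refine ⟨(a, ⟨η, hη⟩), ?_, rfl⟩
  change _ ∈ LinearMap.ker F
  rw [LinearMap.mem_ker]
  refine LinearMap.ext fun q => ?_
  rw [hF]
  have h1 := LinearMap.congr_fun hφ q.1
  have h2 : φ (A q.1) = δ ⁅(a : g), (q.1 : g)⁆ := h1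
  rw [hηφ, hA] at h2
  simp [ha0, h2]

end Lower


/-- Let `g` be semisimple of rank `l` (with triangular decomposition
`g = 𝔱 ⊕ 𝔲 ⊕ 𝔲⁻`, Borel `𝔟 = 𝔱 ⊕ 𝔲`), and let `q = 𝔟 ⋉ (𝔲⁻)ᵃ` be its
Inönü–Wigner contraction, realised on `E = 𝔟 × 𝔲⁻` with bracket
`[(b,η),(b',η')] = ([b,b'], p₋[b,η'] − p₋[b',η])`.  The index of `q` equals `l`:
for every `ξ ∈ q*` the kernel of the skew form `(x,y) ↦ ξ [x,y]` (whose corank is the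
dimension of the coadjoint orbit `Q·ξ`) has dimension at least `l`, and this minimum
`l` is attained; i.e. `ind q = dim q − max_ξ dim Q·ξ = l = ind g`. -/
theorem statement_12 {k g : Type*} [Field k] [IsAlgClosed k] [CharZero k]
    [LieRing g] [LieAlgebra k g] [FiniteDimensional k g]
    [LieAlgebra.IsSemisimple k g]
    (𝔱 𝔲 𝔫 : LieSubalgebra k g) [𝔱.IsCartanSubalgebra]
    (𝔟 : LieSubalgebra k g) (hb : 𝔟.toSubmodule = 𝔱.toSubmodule ⊔ 𝔲.toSubmodule)
    (hTU : ∀ t ∈ 𝔱, ∀ x ∈ 𝔲, ⁅t, x⁆ ∈ 𝔲) (hTN : ∀ t ∈ 𝔱, ∀ x ∈ 𝔫, ⁅t, x⁆ ∈ 𝔫)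
    (hnilU : ∀ x ∈ 𝔲, IsNilpotent (LieAlgebra.ad k g x))
    (hnilN : ∀ x ∈ 𝔫, IsNilpotent (LieAlgebra.ad k g x))
    (hκTU : ∀ t ∈ 𝔱, ∀ x ∈ 𝔲, killingForm k g t x = 0)
    (hκTN : ∀ t ∈ 𝔱, ∀ x ∈ 𝔫, killingForm k g t x = 0)
    (hκUU : ∀ x ∈ 𝔲, ∀ y ∈ 𝔲, killingForm k g x y = 0)
    (hκNN : ∀ x ∈ 𝔫, ∀ y ∈ 𝔫, killingForm k g x y = 0)
    (hcompl : IsCompl 𝔟.toSubmodule 𝔫.toSubmodule)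
    (pminus : g →ₗ[k] 𝔫.toSubmodule)
    (hp : pminus = Submodule.linearProjOfIsCompl 𝔫.toSubmodule 𝔟.toSubmodule hcompl.symm)
    (br : (𝔟.toSubmodule × 𝔫.toSubmodule) →ₗ[k] (𝔟.toSubmodule × 𝔫.toSubmodule) →ₗ[k]
      (𝔟.toSubmodule × 𝔫.toSubmodule))
    (hbr1 : ∀ x y, ((br x y).1 : g) = ⁅(x.1 : g), (y.1 : g)⁆)
    (hbr2 : ∀ x y, (br x y).2 = pminus ⁅(x.1 : g), (y.2 : g)⁆ - pminus ⁅(y.1 : g), (x.2 : g)⁆)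
    (l : ℕ) (hl : l = Module.finrank k 𝔱.toSubmodule) :
    (∀ ξ : Module.Dual k (𝔟.toSubmodule × 𝔫.toSubmodule),
      l ≤ Module.finrank k (LinearMap.ker (br.compr₂ ξ))) ∧
    (∃ ξ : Module.Dual k (𝔟.toSubmodule × 𝔫.toSubmodule),
      Module.finrank k (LinearMap.ker (br.compr₂ ξ)) = l) := by
  classical
  set κ := killingForm k g with hκ
  have hsymm : ∀ x y, κ x y = κ y x := fun x y => LieModule.traceForm_comm k g g x y
  have hnd : ∀ x, (∀ y, κ x y = 0) → x = 0 := by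
    intro x hx
    have h1 : x ∈ LinearMap.ker (killingForm k g) := LinearMap.ext hx
    rw [LieAlgebra.IsKilling.ker_killingForm_eq_bot] at h1
    simpa using h1
  have hinv : ∀ x y z, κ ⁅x, y⁆ z = κ x ⁅y, z⁆ := LieModule.traceForm_apply_lie_apply k g g
  let T := 𝔱.toSubmodule
  let U := 𝔲.toSubmodule
  let N := 𝔫.toSubmodule
  let B := 𝔟.toSubmodule
  have hspan : T ⊔ U ⊔ N = ⊤ := by
    have := hcompl.sup_eq_top
    rwa [hb] at this
  have zero := aux_zero κ hnd T U N hspan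
  have hHU : ∀ x ∈ 𝔱, x ∈ 𝔲 → x = 0 := fun x hx hxu =>
    zero x (fun y hy => (hsymm x y).trans (hκTU y hy x hxu)) (fun y hy => hκTU x hx y hy)
      (fun y hy => hκTN x hx y hy)
  have hHN : ∀ x ∈ 𝔱, x ∈ 𝔫 → x = 0 := fun x hx hxn =>
    zero x (fun y hy => (hsymm x y).trans (hκTN y hy x hxn)) (fun y hy => hκTU x hx y hy)
      (fun y hy => hκTN x hx y hy)
  obtain ⟨hd1, hd2, hd3⟩ := aux_dual κ hsymm hnd T U N hspan hκTU hκTN hκUU hκNN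
  have hUB : U ≤ B := by change 𝔲.toSubmodule ≤ 𝔟.toSubmodule; rw [hb]; exact le_sup_right
  have hTB : T ≤ B := by change 𝔱.toSubmodule ≤ 𝔟.toSubmodule; rw [hb]; exact le_sup_left
  have hBmem : ∀ x ∈ B, ∃ t ∈ 𝔱, ∃ u ∈ 𝔲, t + u = x := by
    intro x hx
    have hx' : x ∈ 𝔱.toSubmodule ⊔ 𝔲.toSubmodule := by rw [← hb]; exact hx
    obtain ⟨t, ht, u, hu, h⟩ := Submodule.mem_sup.mp hx'
    exact ⟨t, ht, u, hu, h⟩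
  have hTT : ∀ t ∈ 𝔱, ∀ t' ∈ 𝔱, ⁅t, t'⁆ = 0 := by
    intro t ht t' ht'
    have := trivial_lie_zero 𝔱 𝔱 ⟨t, ht⟩ ⟨t', ht'⟩
    exact congrArg Subtype.val this
  have hUT : ∀ x ∈ 𝔲, ∀ t ∈ 𝔱, ⁅x, t⁆ ∈ 𝔲 := by
    intro x hx t ht
    rw [← lie_skew]
    exact 𝔲.toSubmodule.neg_mem (hTU t ht x hx)
  have hBB : ∀ x ∈ B, ∀ y ∈ B, ⁅x, y⁆ ∈ U := by
    intro x hx y hy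
    obtain ⟨t, ht, u, hu, rfl⟩ := hBmem x hx
    obtain ⟨t', ht', u', hu', rfl⟩ := hBmem y hy
    rw [add_lie, lie_add, lie_add, hTT t ht t' ht', zero_add]
    exact U.add_mem (hTU t ht u' hu') (U.add_mem (hUT u hu t' ht') (𝔲.lie_mem hu hu'))
  have hκUB : ∀ x ∈ U, ∀ y ∈ B, κ x y = 0 := by
    intro x hx y hy
    obtain ⟨t', ht', u', hu', rfl⟩ := hBmem y hy
    rw [map_add, hsymm x t', hκTU t' ht' x hx, hκUU x hx u' hu', add_zero]
  have hdim : l + finrank k U = finrank k B := by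
    have h1 := Submodule.finrank_sup_add_finrank_inf_eq T U
    have h2 : T ⊓ U = ⊥ := by
      rw [Submodule.eq_bot_iff]
      rintro x ⟨h1, h2⟩
      exact hHU x h1 h2
    rw [h2, finrank_bot, add_zero] at h1
    rw [hl]
    change finrank k T + finrank k U = finrank k 𝔟.toSubmodule
    rw [hb]
    exact h1.symm
  let U' : LieSubmodule k 𝔱 g := { U with lie_mem := fun {t x} hx => hTU t t.2 x hx }
  let N' : LieSubmodule k 𝔱 g := { N with lie_mem := fun {t x} hx => hTN t t.2 x hx }
  obtain ⟨h, hh, e, he, f, hef, hhe, hhf, hUe, hNe⟩ := aux_principal (K := k) (L := g) (H := 𝔱)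
    U' N' (fun x hx y hy => 𝔲.lie_mem hx hy) hHU hHN
    (by
      rw [← LieSubmodule.toSubmodule_inj, LieSubmodule.sup_toSubmodule,
        LieSubmodule.sup_toSubmodule]
      exact hspan) hκUU hκNN
  have hkey := aux_key U N h e f hef hhe hhf (hTU h hh) (hTN h hh) hUe hNe
  -- the form attached to a pair
  have hform : ∀ (ξ : Dual k (𝔟.toSubmodule × 𝔫.toSubmodule)) (δ : Dual k g) (x : g), x ∈ U →
      (∀ b : 𝔟.toSubmodule, ξ (b, 0) = δ b) → (∀ η : 𝔫.toSubmodule, ξ (0, η) = κ x η) →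
      ∀ p q, br.compr₂ ξ p q =
        δ ⁅(p.1 : g), (q.1 : g)⁆ + κ ⁅x, (p.1 : g)⁆ q.2 - κ ⁅x, (q.1 : g)⁆ p.2 := by
    intro ξ δ x hx h1 h2 p q
    have hpm : ∀ y, κ x (pminus y) = κ x y := by
      intro y
      have hy : y - pminus y ∈ 𝔟.toSubmodule := by
        have hp' : pminus =
          Submodule.projectionOnto 𝔫.toSubmodule 𝔟.toSubmodule hcompl.symm := hp
        rw [← Submodule.ker_projectionOnto hcompl.symm, ← hp', LinearMap.mem_ker, map_sub,
          sub_eq_zero]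
        rw [hp']
        exact (Submodule.projectionOnto_apply_left hcompl.symm _).symm
      have := hκUB x hx _ hy
      rw [map_sub, sub_eq_zero] at this
      exact this.symm
    have hsplit : br p q = ((br p q).1, 0) + (0, (br p q).2) := by simp
    rw [LinearMap.compr₂_apply, hsplit, map_add, h1, h2, hbr1, hbr2, hinv, hinv]
    simp only [Submodule.coe_sub, map_sub, hpm]
    ring
  have hlower : ∀ ξ : Dual k (𝔟.toSubmodule × 𝔫.toSubmodule),
      l ≤ finrank k (LinearMap.ker (br.compr₂ ξ)) := by
    intro ξ
    obtain ⟨δ, hδ⟩ := LinearMap.exists_extend (ξ ∘ₗ LinearMap.inl k 𝔟.toSubmodule 𝔫.toSubmodule)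
    obtain ⟨x, hx, hxη⟩ := hd1 (ξ ∘ₗ LinearMap.inr k 𝔟.toSubmodule 𝔫.toSubmodule)
    have hF := hform ξ δ x hx (fun b => (LinearMap.congr_fun hδ b).symm) hxη
    let G1 : (B × N) →ₗ[k] (B × N) →ₗ[k] k := LinearMap.compl₁₂ κ
      ((ad k g h : g →ₗ[k] g) ∘ₗ B.subtype ∘ₗ LinearMap.fst k B N)
      (N.subtype ∘ₗ LinearMap.snd k B N)
    let G := G1 - G1.flip
    have hG : ∀ p q, G p q = κ ⁅h, (p.1 : g)⁆ q.2 - κ ⁅h, (q.1 : g)⁆ p.2 := fun p q => rfl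
    have fin1 := aux_semicont (br.compr₂ ξ) G
    have fin2 := aux_semicont ((ad k g h : g →ₗ[k] g) ∘ₗ U.subtype)
      ((ad k g x : g →ₗ[k] g) ∘ₗ U.subtype)
    have hker0 : LinearMap.ker ((ad k g h : g →ₗ[k] g) ∘ₗ U.subtype) = ⊥ := by
      rw [LinearMap.ker_eq_bot']
      rintro ⟨y, hy⟩ hy1
      by_contra hy0
      have hy2 : ⁅h, y⁆ = (0 : k) • y := by rw [zero_smul]; exact hy1
      obtain ⟨m, hm⟩ := hUe y hy (fun h0 => hy0 (Subtype.ext h0)) 0 hy2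
      have : ((2 * (m + 1) : ℕ) : k) = (0 : ℕ) := by push_cast; exact hm.symm
      have := Nat.cast_injective this
      omega
    rw [hker0, finrank_bot] at fin2
    have : Infinite k := inferInstance
    obtain ⟨s, hs⟩ := ((fin1.union (fin2.image (fun r => r⁻¹))).union
      (Set.finite_singleton (0 : k))).exists_notMem
    simp only [Set.mem_union, not_or, Set.mem_singleton_iff] at hs
    obtain ⟨⟨hs1, hs2⟩, hs0⟩ := hs
    have hs1' : finrank k (LinearMap.ker (br.compr₂ ξ + s • G)) ≤
        finrank k (LinearMap.ker (br.compr₂ ξ)) := not_lt.mp hs1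
    refine le_trans ?_ hs1'
    refine aux_lower κ B U N hUB hBB hd2 (x + s • h)
      (B.add_mem (hUB hx) (B.smul_mem s (hTB hh))) ?_ δ _ ?_ l hdim
    · intro y hy hxy
      by_contra hy0
      apply hs2
      refine ⟨s⁻¹, ?_, inv_inv s⟩
      change 0 < _
      rw [Nat.pos_iff_ne_zero, Ne, Submodule.finrank_eq_zero]
      intro hbot
      apply hy0
      have hmem : (⟨y, hy⟩ : U) ∈ LinearMap.ker ((ad k g h : g →ₗ[k] g) ∘ₗ U.subtype +
          s⁻¹ • ((ad k g x : g →ₗ[k] g) ∘ₗ U.subtype)) := by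
        rw [LinearMap.mem_ker]
        change ⁅h, y⁆ + s⁻¹ • ⁅x, y⁆ = 0
        rw [add_lie, smul_lie] at hxy
        have := congrArg (fun z => s⁻¹ • z) hxy
        simp only [smul_add, smul_zero, inv_smul_smul₀ hs0] at this
        rw [add_comm]; exact this
      rw [hbot] at hmem
      simpa using hmem
    · intro p q
      change br.compr₂ ξ p q + s • G p q = _
      rw [hF, hG]
      simp only [add_lie, smul_lie, map_add, map_smul, LinearMap.add_apply, LinearMap.smul_apply,
        smul_eq_mul]
      ring
  refine ⟨hlower, ?_⟩
  let ξ : Dual k (𝔟.toSubmodule × 𝔫.toSubmodule) :=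
    (κ e ∘ₗ 𝔫.toSubmodule.subtype) ∘ₗ LinearMap.snd k 𝔟.toSubmodule 𝔫.toSubmodule
  refine ⟨ξ, le_antisymm ?_ (hlower ξ)⟩
  have hF := hform ξ 0 e he (fun b => by simp [ξ]) (fun η => by simp [ξ])
  let A : B →ₗ[k] U := ((ad k g e : g →ₗ[k] g) ∘ₗ B.subtype).codRestrict U
    (fun b => hBB e (hUB he) b b.2)
  have hA : ∀ b : B, (A b : g) = ⁅e, (b : g)⁆ := fun b => rfl
  have hη0 : ∀ η ∈ N, (∀ b ∈ B, κ ⁅e, b⁆ η = 0) → η = 0 := by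
    intro η hη hb0
    have hb1 : ∀ b ∈ B, κ b ⁅e, η⁆ = 0 := by
      intro b hb
      rw [← hinv, ← lie_skew, map_neg, LinearMap.neg_apply, hb0 b hb, neg_zero]
    exact hkey η hη (hd3 _ (fun t ht => hb1 t (hTB ht)) (fun u hu => hb1 u (hUB hu)))
  have hsurj : Function.Surjective A := by
    rw [← LinearMap.dualMap_injective_iff, injective_iff_map_eq_zero]
    intro φ hφ
    obtain ⟨η, hη, hηφ⟩ := hd2 φ
    have : η = 0 := hη0 η hη (fun b hb => by
      have := LinearMap.congr_fun hφ ⟨b, hb⟩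
      have h2 : φ (A ⟨b, hb⟩) = 0 := this
      rw [hηφ] at h2
      exact h2)
    ext y
    rw [hηφ, this]; simp
  have hker : finrank k (LinearMap.ker A) = l := by
    have := A.finrank_range_add_finrank_ker
    rw [LinearMap.range_eq_top.mpr hsurj, finrank_top] at this
    omega
  rw [← hker]
  refine le_trans (Submodule.finrank_mono (t := (LinearMap.ker A).map (LinearMap.inl k B N)) ?_)
    (Submodule.finrank_map_le _ _)
  rintro ⟨a, η⟩ hp0
  have hp1 : ∀ q, br.compr₂ ξ (a, η) q = 0 := fun q =>
    LinearMap.congr_fun (LinearMap.mem_ker.mp hp0) q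
  have hηz : (η : g) = 0 := by
    refine hη0 η η.2 fun b hb => ?_
    have := hp1 (⟨b, hb⟩, 0)
    rw [hF] at this
    simpa using this
  have haz : A a = 0 := by
    apply Subtype.ext
    refine zero (A a) (fun y hy => ?_) (fun y hy => hκUU _ (A a).2 y hy) (fun y hy => ?_)
    · exact hκUB _ (A a).2 y (hTB hy)
    · have := hp1 (0, ⟨y, hy⟩)
      rw [hF] at this
      simpa [hA] using this
  refine ⟨a, haz, ?_⟩
  refine Prod.ext rfl ?_
  exact Subtype.ext hηz.symm
end
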